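/- Consider N = 2 channels and the myopic (greedy) rule Γ_g with independent uniform priors: the user maintains the Bayesian posterior under independent Uniform[0,1] priors on θ_1 and θ_2 (so after sensing channel i a total of Y_i times with X_i free outcomes, the posterior mean of θ_i is (X_i + 1)/(Y_i + 2)), and at each slot senses the channel whose current posterior mean is largest, breaking ties in favor of channel 1. Then for every θ = (θ_1, θ_2) with 1/2 < θ_1 < θ_2 < 1, there exist c > 0 and T_0 such that L(θ;Γ_g,T) ≥ c·T for all T ≥ T_0. Hence the myopic rule has loss of linear order in T and is not consistent. -/

import Mathlib

open MeasureTheory ProbabilityTheory Filter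
open scoped BigOperators ENNReal

/-- A deterministic medium-access strategy: it maps the history of
(sensed channel, observed outcome) pairs to the channel to be sensed in the next slot. -/
def Strategy (N : ℕ) : Type := List (Fin N × Bool) → Fin N

/-- The history of (channel, outcome) pairs accumulated after `j` (0-indexed) slots, given
the full availability table `ω` (`ω j i = true` iff channel `i` is free in slot `j`). -/
def Strategy.hist {N : ℕ} (Γ : Strategy N) (ω : ℕ → Fin N → Bool) :
    ℕ → List (Fin N × Bool)
  | 0 => []
  | j + 1 =>
    Strategy.hist Γ ω j ++
      [(Γ (Strategy.hist Γ ω j), ω j (Γ (Strategy.hist Γ ω j)))]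

/-- The channel selected by strategy `Γ` at (0-indexed) slot `j`. -/
def Strategy.sel {N : ℕ} (Γ : Strategy N) (ω : ℕ → Fin N → Bool) (j : ℕ) : Fin N :=
  Γ (Γ.hist ω j)

/-- Extension of a finite availability table to all time slots. -/
def extendOut {N T : ℕ} (ω : Fin T → Fin N → Bool) : ℕ → Fin N → Bool :=
  fun j i => if h : j < T then ω ⟨j, h⟩ i else false

/-- The probability of observing the availability table `ω` when each channel `i` is free
in each slot independently with probability `θ i`. -/
def outWt {N T : ℕ} (θ : Fin N → ℝ) (ω : Fin T → Fin N → Bool) : ℝ :=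
  ∏ j : Fin T, ∏ i : Fin N, (if ω j i then θ i else 1 - θ i)

/-- `W B θ T Γ`: the expected number of bits transmitted over a block of `T` slots by the
cognitive user employing strategy `Γ`, when `B` bits are sent each time the sensed channel
is free, i.e. `E_θ[∑_{j=1}^T B · Z_{S(j)}(j)]`. -/
noncomputable def W {N : ℕ} (B : ℝ) (θ : Fin N → ℝ) (T : ℕ) (Γ : Strategy N) : ℝ :=
  ∑ ω : Fin T → Fin N → Bool, outWt θ ω *
    ∑ j ∈ Finset.range T, (if extendOut ω j (Γ.sel (extendOut ω) j) then B else 0)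

/-- `probSel θ T Γ j i`: the probability that strategy `Γ` selects channel `i` at
(0-indexed) slot `j`, under parameter `θ`. -/
noncomputable def probSel {N : ℕ} (θ : Fin N → ℝ) (T : ℕ) (Γ : Strategy N)
    (j : ℕ) (i : Fin N) : ℝ :=
  ∑ ω : Fin T → Fin N → Bool, (if Γ.sel (extendOut ω) j = i then outWt θ ω else 0)

/-- `expY θ T Γ i`: the expected number of slots among the first `T` in which strategy `Γ`
senses channel `i`, i.e. `E_θ[Y_i(T)]`. -/
noncomputable def expY {N : ℕ} (θ : Fin N → ℝ) (T : ℕ) (Γ : Strategy N) (i : Fin N) : ℝ :=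
  ∑ ω : Fin T → Fin N → Bool, outWt θ ω *
    (((Finset.range T).filter fun j => Γ.sel (extendOut ω) j = i).card : ℝ)

/-- The throughput loss of strategy `Γ` over a block of `T` slots, relative to always
sensing a best channel `istar`: `L(θ;Γ,T) = T·B·θ_{i*} − W_Γ(θ,T)`. -/
noncomputable def Loss {N : ℕ} (B : ℝ) (θ : Fin N → ℝ) (istar : Fin N) (T : ℕ)
    (Γ : Strategy N) : ℝ :=
  T * B * θ istar - W B θ T Γ

/-- A family of strategies (one for each horizon `T`) is consistent if for every
`θ ∈ [0,1]^N` there are `β < 1` and `C > 0` with `L(θ;Γ_T,T) ≤ C·T^β` for all `T ≥ 1`. -/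
def Consistent {N : ℕ} (B : ℝ) (Γ : ℕ → Strategy N) : Prop :=
  ∀ θ : Fin N → ℝ, (∀ i, θ i ∈ Set.Icc (0:ℝ) 1) →
    ∀ istar : Fin N, (∀ k, θ k ≤ θ istar) →
      ∃ β C : ℝ, β < 1 ∧ 0 < C ∧
        ∀ T : ℕ, 1 ≤ T → Loss B θ istar T (Γ T) ≤ C * (T : ℝ) ^ β

/-- The Bayesian expected throughput of strategy `Γ` under prior `f`. -/
noncomputable def WBayes {N : ℕ} (B : ℝ) (T : ℕ) (Γ : Strategy N)
    (f : Measure (Fin N → ℝ)) : ℝ :=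
  ∫ θ, W B θ T Γ ∂f

/-- The optimal Bayesian value `V*(f,T) = sup_Γ W_Γ(f,T)`. -/
noncomputable def Vstar {N : ℕ} (B : ℝ) (T : ℕ) (f : Measure (Fin N → ℝ)) : ℝ :=
  ⨆ Γ : Strategy N, WBayes B T Γ f

/-- The Bayesian posterior after sensing channel `i` and observing outcome `z`:
`f_{z_i=1}` has density `θ_i / ∫θ_i f(dθ)` w.r.t. `f`, and `f_{z_i=0}` has density
`(1−θ_i) / ∫(1−θ_i) f(dθ)` w.r.t. `f`. -/
noncomputable def posterior {N : ℕ} (f : Measure (Fin N → ℝ)) (i : Fin N) (z : Bool) :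
    Measure (Fin N → ℝ) :=
  if z then f.withDensity fun θ => ENNReal.ofReal (θ i / ∫ θ', θ' i ∂f)
  else f.withDensity fun θ => ENNReal.ofReal ((1 - θ i) / ∫ θ', (1 - θ' i) ∂f)

/-- Kullback–Leibler divergence between Bernoulli(a) and Bernoulli(b). -/
noncomputable def klBernoulli (a b : ℝ) : ℝ :=
  a * Real.log (a / b) + (1 - a) * Real.log ((1 - a) / (1 - b))

/-- The myopic (greedy) rule for `N = 2` channels under independent `Uniform[0,1]` priors:
after sensing channel `i` a total of `Y_i` times with `X_i` free outcomes, the posterior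
mean of `θ_i` is `(X_i + 1)/(Y_i + 2)`; at each slot the channel with the largest current
posterior mean is sensed, ties being broken in favor of the first channel (index `0`). -/
noncomputable def greedyTwo : Strategy 2 := fun h => by
  classical
  exact
    let pm : Fin 2 → ℝ := fun i =>
      (((h.filter fun p => p.1 == i && p.2).length : ℝ) + 1) /
        (((h.filter fun p => p.1 == i).length : ℝ) + 2)
    if pm 0 < pm 1 then 1 else 0

/-- The expectation of a functional of the history after `T` slots. -/
noncomputable def expHist {N : ℕ} (θ : Fin N → ℝ) (Γ : Strategy N) (T : ℕ)
    (F : List (Fin N × Bool) → ℝ) : ℝ :=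
  ∑ ω : Fin T → Fin N → Bool, outWt θ ω * F (Γ.hist (extendOut ω) T)

/-- One step of the conditional expectation of `F` along the history process. -/
noncomputable def stepHist {N : ℕ} (θ : Fin N → ℝ) (Γ : Strategy N)
    (F : List (Fin N × Bool) → ℝ) (h : List (Fin N × Bool)) : ℝ :=
  θ (Γ h) * F (h ++ [(Γ h, true)]) + (1 - θ (Γ h)) * F (h ++ [(Γ h, false)])

theorem Strategy.hist_congr {N : ℕ} (Γ : Strategy N) {ω ω' : ℕ → Fin N → Bool} {T : ℕ}
    (h : ∀ j < T, ω j = ω' j) : Γ.hist ω T = Γ.hist ω' T := by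
  induction T with
  | zero => rfl
  | succ T ih =>
    simp only [Strategy.hist, ih fun j hj => h j (hj.trans T.lt_succ_self),
      h T T.lt_succ_self]

theorem extendOut_snoc_of_lt {N T : ℕ} (ω : Fin T → Fin N → Bool) (z : Fin N → Bool) {j : ℕ}
    (hj : j < T) :
    extendOut (Fin.snoc ω z : Fin (T + 1) → Fin N → Bool) j = extendOut ω j := by
  funext i
  simp [extendOut, hj, hj.trans T.lt_succ_self, Fin.snoc]

theorem extendOut_snoc_self {N T : ℕ} (ω : Fin T → Fin N → Bool) (z : Fin N → Bool) :
    extendOut (Fin.snoc ω z : Fin (T + 1) → Fin N → Bool) T = z := by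
  funext i
  simp [extendOut, Fin.snoc]

theorem outWt_snoc {N T : ℕ} (θ : Fin N → ℝ) (ω : Fin T → Fin N → Bool) (z : Fin N → Bool) :
    outWt θ (Fin.snoc ω z : Fin (T + 1) → Fin N → Bool) =
      outWt θ ω * ∏ i, (if z i then θ i else 1 - θ i) := by
  simp [outWt, Fin.prod_univ_castSucc]

theorem outWt_nonneg {N T : ℕ} {θ : Fin N → ℝ} (hθ : ∀ i, θ i ∈ Set.Icc (0 : ℝ) 1)
    (ω : Fin T → Fin N → Bool) : 0 ≤ outWt θ ω := by
  refine Finset.prod_nonneg fun j _ => Finset.prod_nonneg fun i _ => ?_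
  split_ifs
  · exact (hθ i).1
  · exact sub_nonneg.2 (hθ i).2

theorem sum_bernoulli_mul_apply {N : ℕ} (θ : Fin N → ℝ) (s : Fin N) (f : Bool → ℝ) :
    ∑ z : Fin N → Bool, (∏ i, (if z i then θ i else 1 - θ i)) * f (z s) =
      θ s * f true + (1 - θ s) * f false := by
  have key : ∀ z : Fin N → Bool, (∏ i, (if z i then θ i else 1 - θ i)) * f (z s) =
      ∏ i, ((if z i then θ i else 1 - θ i) * if i = s then f (z i) else 1) := fun z => by
    rw [Finset.prod_mul_distrib, Finset.prod_ite_eq' Finset.univ s fun i => f (z i)]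
    simp
  simp_rw [key]
  rw [← Fintype.prod_sum fun i b => (if b then θ i else 1 - θ i) * if i = s then f b else 1,
    Finset.prod_eq_single s]
  · simp
  · intro i _ hi
    simp [hi]
  · simp

theorem expHist_zero {N : ℕ} (θ : Fin N → ℝ) (Γ : Strategy N)
    (F : List (Fin N × Bool) → ℝ) : expHist θ Γ 0 F = F [] := by
  simp [expHist, outWt, Strategy.hist]

theorem expHist_succ {N : ℕ} (θ : Fin N → ℝ) (Γ : Strategy N) (T : ℕ)
    (F : List (Fin N × Bool) → ℝ) :
    expHist θ Γ (T + 1) F = expHist θ Γ T (stepHist θ Γ F) := by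
  unfold expHist
  rw [← (Fin.snocEquiv fun _ : Fin (T + 1) => Fin N → Bool).sum_comp,
    Fintype.sum_prod_type, Finset.sum_comm]
  refine Finset.sum_congr rfl fun ω _ => ?_
  have hhist : ∀ z : Fin N → Bool,
      Γ.hist (extendOut (Fin.snoc ω z : Fin (T + 1) → Fin N → Bool)) T =
        Γ.hist (extendOut ω) T :=
    fun z => Γ.hist_congr fun j hj => extendOut_snoc_of_lt ω z hj
  have hstep := sum_bernoulli_mul_apply θ (Γ (Γ.hist (extendOut ω) T)) fun b =>
    F (Γ.hist (extendOut ω) T ++ [(Γ (Γ.hist (extendOut ω) T), b)])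
  rw [stepHist, ← hstep, Finset.mul_sum]
  refine Finset.sum_congr rfl fun z _ => ?_
  change outWt θ (Fin.snoc ω z : Fin (T + 1) → Fin N → Bool) *
    F (Γ.hist (extendOut (Fin.snoc ω z : Fin (T + 1) → Fin N → Bool)) (T + 1)) = _
  rw [outWt_snoc, Strategy.hist, hhist, extendOut_snoc_self, mul_assoc]

theorem expHist_mono {N : ℕ} {θ : Fin N → ℝ} (hθ : ∀ i, θ i ∈ Set.Icc (0 : ℝ) 1)
    (Γ : Strategy N) (T : ℕ) {F G : List (Fin N × Bool) → ℝ} (h : ∀ l, F l ≤ G l) :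
    expHist θ Γ T F ≤ expHist θ Γ T G :=
  Finset.sum_le_sum fun ω _ => mul_le_mul_of_nonneg_left (h _) (outWt_nonneg hθ ω)

theorem expHist_const {N : ℕ} (θ : Fin N → ℝ) (Γ : Strategy N) (T : ℕ) (c : ℝ) :
    expHist θ Γ T (fun _ => c) = c := by
  induction T with
  | zero => exact expHist_zero ..
  | succ T ih =>
    rw [expHist_succ, ← ih]
    congr 1
    funext h
    rw [stepHist, ih]
    ring

/-- The number of slots recorded as free in a history. -/
def freeCount {N : ℕ} (h : List (Fin N × Bool)) : ℕ := h.countP fun p => p.2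

theorem W_eq_expHist {N : ℕ} (B : ℝ) (θ : Fin N → ℝ) (T : ℕ) (Γ : Strategy N) :
    W B θ T Γ = B * expHist θ Γ T fun h => (freeCount h : ℝ) := by
  have key : ∀ (ω : ℕ → Fin N → Bool) (T : ℕ),
      ∑ j ∈ Finset.range T, (if ω j (Γ.sel ω j) then B else 0) =
        B * (freeCount (Γ.hist ω T) : ℝ) := fun ω T => by
    induction T with
    | zero => simp [freeCount, Strategy.hist]
    | succ T ih =>
      rw [Finset.sum_range_succ, ih]
      by_cases hz : ω T (Γ (Γ.hist ω T)) <;>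
        simp [freeCount, Strategy.hist, Strategy.sel, hz, mul_add]
  simp only [W, expHist, key, Finset.mul_sum]
  exact Finset.sum_congr rfl fun ω _ => by ring

theorem stepHist_freeCount {N : ℕ} (θ : Fin N → ℝ) (Γ : Strategy N)
    (h : List (Fin N × Bool)) :
    stepHist θ Γ (fun h => (freeCount h : ℝ)) h = freeCount h + θ (Γ h) := by
  simp [stepHist, freeCount]
  ring

/-- For a history that only contains channel `0`, the greedy rule stays on channel `0` when
at least half of the observed slots were free. -/
theorem greedyTwo_eq_zero {h : List (Fin 2 × Bool)} (hh : ∀ p ∈ h, p.1 = 0)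
    (hf : h.length ≤ 2 * freeCount h) : greedyTwo h = 0 := by
  have e1 : (h.filter fun p => p.1 == 0 && p.2).length = freeCount h := by
    rw [freeCount, List.countP_eq_length_filter]
    congr 1
    exact List.filter_congr fun p hp => by simp [hh p hp]
  have e2 : (h.filter fun p => p.1 == 0) = h :=
    List.filter_eq_self.2 fun p hp => by simp [hh p hp]
  have e3 : (h.filter fun p => p.1 == 1 && p.2) = [] :=
    List.filter_eq_nil_iff.2 fun p hp => by simp [hh p hp]
  have e4 : (h.filter fun p => p.1 == 1) = [] :=
    List.filter_eq_nil_iff.2 fun p hp => by simp [hh p hp]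
  have hf' : (h.length : ℝ) ≤ 2 * freeCount h := by exact_mod_cast hf
  unfold greedyTwo
  simp only [e1, e2, e3, e4]
  rw [if_neg]
  rw [not_lt, List.length_nil, div_le_div_iff₀ (by norm_num) (by positivity)]
  push_cast
  linarith

open Classical in
/-- The probability, by the gambler's ruin formula, that a history containing only channel `0`
is continued on channel `0` forever by the greedy rule; `r` is the odds ratio
`(1 - θ 0) / θ 0`. -/
noncomputable def stuckProb (r : ℝ) (h : List (Fin 2 × Bool)) : ℝ :=
  if ∀ p ∈ h, p.1 = 0 then 1 - r ^ (2 * freeCount h + 1 - h.length) else 0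

theorem stuckProb_nonneg {r : ℝ} (hr0 : 0 ≤ r) (hr1 : r ≤ 1) (h : List (Fin 2 × Bool)) :
    0 ≤ stuckProb r h := by
  unfold stuckProb
  split_ifs
  · exact sub_nonneg.2 (pow_le_one₀ hr0 hr1)
  · exact le_rfl

theorem stuckProb_le_one {r : ℝ} (hr0 : 0 ≤ r) (h : List (Fin 2 × Bool)) :
    stuckProb r h ≤ 1 := by
  unfold stuckProb
  split_ifs
  · exact sub_le_self _ (pow_nonneg hr0 _)
  · exact zero_le_one

theorem stuckProb_eq_zero {r : ℝ} {h : List (Fin 2 × Bool)}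
    (hh : ¬((∀ p ∈ h, p.1 = 0) ∧ h.length ≤ 2 * freeCount h)) : stuckProb r h = 0 := by
  unfold stuckProb
  split_ifs with h0
  · have : 2 * freeCount h + 1 - h.length = 0 := by
      have : ¬h.length ≤ 2 * freeCount h := fun hl => hh ⟨h0, hl⟩
      omega
    simp [this]
  · rfl

theorem stuckProb_le_stepHist {θ : Fin 2 → ℝ} (hθ : ∀ i, θ i ∈ Set.Icc (0 : ℝ) 1) {r : ℝ}
    (hr0 : 0 ≤ r) (hr1 : r ≤ 1) (hr : θ 0 * r = 1 - θ 0) (h : List (Fin 2 × Bool)) :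
    stuckProb r h ≤ stepHist θ greedyTwo (stuckProb r) h := by
  by_cases hh : (∀ p ∈ h, p.1 = 0) ∧ h.length ≤ 2 * freeCount h
  · obtain ⟨k, hk⟩ := Nat.exists_eq_add_of_le hh.2
    have hall : ∀ b, ∀ p ∈ h ++ [((0 : Fin 2), b)], p.1 = 0 := fun b p hp => by
      rcases List.mem_append.1 hp with hp | hp
      · exact hh.1 p hp
      · simp_all
    have ct : freeCount (h ++ [((0 : Fin 2), true)]) = freeCount h + 1 := by
      simp [freeCount]
    have cf : freeCount (h ++ [((0 : Fin 2), false)]) = freeCount h := by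
      simp [freeCount]
    rw [stepHist, greedyTwo_eq_zero hh.1 hh.2, stuckProb, stuckProb, stuckProb,
      if_pos hh.1, if_pos (hall _), if_pos (hall _), ct, cf]
    simp only [List.length_append, List.length_singleton]
    rw [show 2 * freeCount h + 1 - h.length = k + 1 by omega,
      show 2 * (freeCount h + 1) + 1 - (h.length + 1) = k + 2 by omega,
      show 2 * freeCount h + 1 - (h.length + 1) = k by omega]
    refine le_of_eq ?_
    linear_combination (r ^ (k + 1) - r ^ k) * hr
  · rw [stuckProb_eq_zero hh]
    exact add_nonneg (mul_nonneg (hθ _).1 (stuckProb_nonneg hr0 hr1 _))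
      (mul_nonneg (sub_nonneg.2 (hθ _).2) (stuckProb_nonneg hr0 hr1 _))

theorem one_sub_le_expHist_stuckProb {θ : Fin 2 → ℝ} (hθ : ∀ i, θ i ∈ Set.Icc (0 : ℝ) 1)
    {r : ℝ} (hr0 : 0 ≤ r) (hr1 : r ≤ 1) (hr : θ 0 * r = 1 - θ 0) (T : ℕ) :
    1 - r ≤ expHist θ greedyTwo T (stuckProb r) := by
  induction T with
  | zero => simp [expHist_zero, stuckProb, freeCount]
  | succ T ih =>
    rw [expHist_succ]
    exact ih.trans (expHist_mono hθ _ _ (stuckProb_le_stepHist hθ hr0 hr1 hr))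

theorem greedyTwo_mean_le {θ : Fin 2 → ℝ} (h01 : θ 0 ≤ θ 1) {r : ℝ} (hr0 : 0 ≤ r)
    (h : List (Fin 2 × Bool)) :
    θ (greedyTwo h) ≤ θ 1 - (θ 1 - θ 0) * stuckProb r h := by
  have hle : θ (greedyTwo h) ≤ θ 1 := by
    generalize greedyTwo h = i
    fin_cases i
    exacts [h01, le_rfl]
  by_cases hh : (∀ p ∈ h, p.1 = 0) ∧ h.length ≤ 2 * freeCount h
  · rw [greedyTwo_eq_zero hh.1 hh.2]
    nlinarith [stuckProb_le_one hr0 h]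
  · rwa [stuckProb_eq_zero hh, mul_zero, sub_zero]

theorem expHist_freeCount_le {θ : Fin 2 → ℝ} (hθ : ∀ i, θ i ∈ Set.Icc (0 : ℝ) 1)
    (h01 : θ 0 ≤ θ 1) {r : ℝ} (hr0 : 0 ≤ r) (hr1 : r ≤ 1) (hr : θ 0 * r = 1 - θ 0) (T : ℕ) :
    (expHist θ greedyTwo T fun h => (freeCount h : ℝ)) ≤
      T * (θ 1 - (θ 1 - θ 0) * (1 - r)) := by
  induction T with
  | zero => simp [expHist_zero, freeCount]
  | succ T ih =>
    have hlin : (expHist θ greedyTwo T fun h =>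
          (freeCount h : ℝ) + (θ 1 - (θ 1 - θ 0) * stuckProb r h)) =
        (expHist θ greedyTwo T fun h => (freeCount h : ℝ)) +
          ((expHist θ greedyTwo T fun _ => θ 1) -
            (θ 1 - θ 0) * expHist θ greedyTwo T (stuckProb r)) := by
      simp only [expHist, Finset.mul_sum, ← Finset.sum_sub_distrib, ← Finset.sum_add_distrib]
      exact Finset.sum_congr rfl fun ω _ => by ring
    have hmono := expHist_mono (F := stepHist θ greedyTwo fun h => (freeCount h : ℝ))
      (G := fun h => (freeCount h : ℝ) + (θ 1 - (θ 1 - θ 0) * stuckProb r h)) hθ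
      greedyTwo T fun h => by
        rw [stepHist_freeCount]
        exact add_le_add_right (greedyTwo_mean_le h01 hr0 h) (freeCount h : ℝ)
    rw [hlin, expHist_const] at hmono
    have hstuck := mul_le_mul_of_nonneg_left
      (one_sub_le_expHist_stuckProb hθ hr0 hr1 hr T) (sub_nonneg.2 h01)
    rw [expHist_succ]
    push_cast
    linarith

/-- For `N = 2` channels and the myopic rule with independent uniform
priors: for every `θ = (θ₁, θ₂)` with `1/2 < θ₁ < θ₂ < 1` (here `θ₁ = θ 0`, `θ₂ = θ 1`,
so the best channel is index `1`), there exist `c > 0` and `T₀` such that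
`L(θ;Γ_g,T) ≥ c·T` for all `T ≥ T₀`: the myopic rule has loss of linear order in `T`
and hence is not consistent. -/
theorem myopic_rule_linear_loss (B : ℝ) (hB : 0 < B) (θ : Fin 2 → ℝ)
    (h0 : 1 / 2 < θ 0) (h01 : θ 0 < θ 1) (h1 : θ 1 < 1) :
    ∃ c : ℝ, 0 < c ∧ ∃ T₀ : ℕ, ∀ T : ℕ, T₀ ≤ T →
      c * T ≤ Loss B θ 1 T greedyTwo := by
  have hpos : 0 < θ 0 := by linarith
  have hθ : ∀ i, θ i ∈ Set.Icc (0 : ℝ) 1 := by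
    intro i
    fin_cases i
    · exact ⟨hpos.le, (h01.trans h1).le⟩
    · exact ⟨(hpos.trans h01).le, h1.le⟩
  have hr0 : 0 ≤ (1 - θ 0) / θ 0 := div_nonneg (by linarith) hpos.le
  have hr1 : (1 - θ 0) / θ 0 < 1 := by
    rw [div_lt_one hpos]
    linarith
  have hr : θ 0 * ((1 - θ 0) / θ 0) = 1 - θ 0 := mul_div_cancel₀ _ hpos.ne'
  refine ⟨B * ((θ 1 - θ 0) * (1 - (1 - θ 0) / θ 0)),
    mul_pos hB (mul_pos (sub_pos.2 h01) (sub_pos.2 hr1)), 0, fun T _ => ?_⟩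
  have hle := mul_le_mul_of_nonneg_left
    (expHist_freeCount_le hθ h01.le hr0 hr1.le hr T) hB.le
  rw [Loss, W_eq_expHist]
  linarith
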